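/- The dual immaculate quasi-symmetric function expands positively in the fundamental basis: 𝔖*_α = Σ_T F_{D(T)}, summing over all standard immaculate tableaux T of shape α, where D(T) is the descent composition of T. -/

import Mathlib

open Classical in
/-- The monomial quasi-symmetric function `M_α`, as a formal power series in the
variables indexed by `ℕ`, defined by its coefficients. -/
noncomputable def Mqs (α : List ℕ) : MvPowerSeries ℕ ℚ :=
  fun d : ℕ →₀ ℕ =>
    if ∃ f : Fin α.length → ℕ, StrictMono f ∧
        d = ∑ i : Fin α.length, Finsupp.single (f i) (α.get i) then 1 else 0

/-- `S(α)`: the set of proper partial sums of a composition `α` of `n`. -/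
def compS {n : ℕ} (c : Composition n) : Finset ℕ :=
  (Finset.Ico 1 c.length).image c.sizeUpTo

/-- The fundamental quasi-symmetric function `F_α = Σ_{β ≤ α} M_β`, summed over the
refinements `β` of `α` (i.e. `S(α) ⊆ S(β)`). -/
noncomputable def Fqs {n : ℕ} (α : Composition n) : MvPowerSeries ℕ ℚ :=
  ∑ β ∈ Finset.univ.filter (fun β : Composition n => compS α ⊆ compS β), Mqs β.blocks

/-- An immaculate tableau of shape `α` and content `β`, encoded as a list of rows. -/
def IsImmaculate (T : List (List ℕ)) (α β : List ℕ) : Prop :=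
  T.map List.length = α ∧
  (∀ r ∈ T, List.Chain' (· ≤ ·) r) ∧
  List.Chain' (· < ·) (T.map List.headI) ∧
  (∀ x ∈ T.flatten, 0 < x) ∧
  (∀ i : ℕ, T.flatten.count (i + 1) = β.getD i 0)

/-- `K_{α,β}`: the number of immaculate tableaux of shape `α` and content `β`. -/
noncomputable def Kab {n : ℕ} (α β : Composition n) : ℕ :=
  Nat.card {T : List (List ℕ) // IsImmaculate T α.blocks β.blocks}

/-- The dual immaculate quasi-symmetric function `𝔖*_α = Σ_β K_{α,β} M_β`
(the basis of QSym dual to the immaculate basis of NSym, which is defined by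
`H_β = Σ_α K_{α,β} 𝔖_α` and the pairing `⟨H_α, M_β⟩ = δ_{α,β}`). -/
noncomputable def dualImmaculate {n : ℕ} (α : Composition n) : MvPowerSeries ℕ ℚ :=
  ∑ β : Composition n, (Kab α β : ℚ) • Mqs β.blocks

/-- The (0-based) index of the row of `T` containing the entry `x`. -/
def rowIdx (T : List (List ℕ)) (x : ℕ) : ℕ :=
  T.findIdx fun r => decide (x ∈ r)

/-- The descent set of a standard immaculate tableau `T` with `n` cells:
`i` is a descent if `i+1` lies in a row strictly below `i`. -/
def descSet (T : List (List ℕ)) (n : ℕ) : Finset ℕ :=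
  (Finset.Ico 1 n).filter fun i => rowIdx T i < rowIdx T (i + 1)

namespace DualImm

/-- Cells of the diagram of `α`. -/
abbrev Cell {n : ℕ} (α : Composition n) : Type :=
  (i : Fin α.length) × Fin (α.blocksFun i)

theorem card_cell {n : ℕ} (α : Composition n) : Fintype.card (Cell α) = n := by
  rw [Fintype.card_congr α.blocksFinEquiv, Fintype.card_fin]

/-- First cell of a row. -/
def first {n : ℕ} (α : Composition n) (i : Fin α.length) : Cell α :=
  ⟨i, ⟨0, α.one_le_blocksFun i⟩⟩

/-- The list-of-rows tableau of a filling. -/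
def tab {n : ℕ} {α : Composition n} (f : Cell α → ℕ) : List (List ℕ) :=
  List.ofFn fun i => List.ofFn fun j => f ⟨i, j⟩

/-- Immaculate condition on fillings. -/
structure FImm {n : ℕ} {α : Composition n} (f : Cell α → ℕ) (β : Composition n) : Prop where
  row : ∀ (i : Fin α.length) (j j' : Fin (α.blocksFun i)), j < j' → f ⟨i, j⟩ ≤ f ⟨i, j'⟩
  col : ∀ i i' : Fin α.length, i < i' → f (first α i) < f (first α i')
  cum : ∀ v, (Finset.univ.filter fun c => f c ≤ v).card = β.sizeUpTo v

theorem tab_injective {n : ℕ} {α : Composition n} :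
    Function.Injective (tab : (Cell α → ℕ) → _) := by
  intro f g h
  funext ⟨i, j⟩
  have h1 := congrFun (List.ofFn_injective h) i
  exact congrFun (List.ofFn_injective h1) j

theorem tab_lengths {n : ℕ} {α : Composition n} (f : Cell α → ℕ) :
    (tab f).map List.length = α.blocks := by
  rw [tab, List.map_ofFn, ← α.ofFn_blocksFun]
  congr 1
  funext i
  simp

theorem exists_tab {n : ℕ} {α : Composition n} (T : List (List ℕ))
    (hT : T.map List.length = α.blocks) : ∃ f : Cell α → ℕ, tab f = T := by
  have hl : T.length = α.length := by
    rw [← α.blocks_length, ← hT, List.length_map]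
  refine ⟨fun c => (T.getD c.1 []).getD c.2 0, ?_⟩
  apply List.ext_getElem
  · simp [tab, hl]
  · intro i h1 h2
    have hi : i < α.length := hl ▸ h2
    have hb : α.blocksFun ⟨i, hi⟩ = T[i].length := by
      have : α.blocks[i]'(by simpa using hi) = T[i].length := by
        simp [← hT]
      simpa [Composition.blocksFun] using this
    apply List.ext_getElem
    · simp [tab, hb]
    · intro j h3 h4
      simp [tab, h2, h4]

theorem mem_flatten_tab {n : ℕ} {α : Composition n} (f : Cell α → ℕ) (x : ℕ) :
    x ∈ (tab f).flatten ↔ ∃ c, f c = x := by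
  simp [tab, List.mem_ofFn, Sigma.exists]

theorem count_ofFn {k : ℕ} (g : Fin k → ℕ) (x : ℕ) :
    (List.ofFn g).count x = (Finset.univ.filter fun j => g j = x).card := by
  rw [← Multiset.coe_count, ← Fin.univ_val_map, Multiset.count_map, Finset.card_def,
    Finset.filter_val]
  simp [eq_comm]

theorem count_flatten_tab {n : ℕ} {α : Composition n} (f : Cell α → ℕ) (x : ℕ) :
    (tab f).flatten.count x = (Finset.univ.filter fun c => f c = x).card := by
  rw [List.count_flatten, tab, List.map_ofFn, List.sum_ofFn]
  simp only [Function.comp, count_ofFn, Finset.card_filter]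
  rw [Fintype.sum_sigma]

theorem sizeUpTo_succ_getD {n : ℕ} (β : Composition n) (i : ℕ) :
    β.sizeUpTo (i + 1) = β.sizeUpTo i + β.blocks.getD i 0 := by
  by_cases h : i < β.length
  · rw [β.sizeUpTo_succ h]
    simp [h]
  · rw [β.sizeUpTo_ofLength_le _ (by omega), β.sizeUpTo_ofLength_le _ (by omega)]
    rw [List.getD_eq_default]
    · simp
    · simpa using h

theorem card_le_succ {n : ℕ} {α : Composition n} (f : Cell α → ℕ) (v : ℕ) :
    (Finset.univ.filter fun c => f c ≤ v + 1).card =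
      (Finset.univ.filter fun c => f c ≤ v).card +
      (Finset.univ.filter fun c => f c = v + 1).card := by
  rw [← Finset.card_union_of_disjoint]
  · congr 1
    ext c
    simp
    omega
  · rw [Finset.disjoint_filter]
    intro c _ h1 h2
    omega

theorem cum_iff {n : ℕ} {α : Composition n} (f : Cell α → ℕ) (β : Composition n) :
    (∀ v, (Finset.univ.filter fun c => f c ≤ v).card = β.sizeUpTo v) ↔
    (∀ x ∈ (tab f).flatten, 0 < x) ∧
      (∀ i : ℕ, (tab f).flatten.count (i + 1) = β.blocks.getD i 0) := by
  constructor
  · intro h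
    constructor
    · intro x hx
      obtain ⟨c, rfl⟩ := (mem_flatten_tab f x).1 hx
      have h0 := h 0
      rw [β.sizeUpTo_zero, Finset.card_eq_zero, Finset.filter_eq_empty_iff] at h0
      have := h0 (Finset.mem_univ c)
      omega
    · intro i
      rw [count_flatten_tab]
      have h1 := card_le_succ f i
      rw [h, h, sizeUpTo_succ_getD] at h1
      omega
  · rintro ⟨h0, h⟩ v
    induction v with
    | zero =>
      rw [β.sizeUpTo_zero, Finset.card_eq_zero, Finset.filter_eq_empty_iff]
      intro c _
      have := h0 (f c) ((mem_flatten_tab f _).2 ⟨c, rfl⟩)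
      omega
    | succ v ih =>
      rw [card_le_succ, ih, sizeUpTo_succ_getD, ← h, count_flatten_tab]

theorem heads_tab {n : ℕ} {α : Composition n} (f : Cell α → ℕ) :
    (tab f).map List.headI = List.ofFn fun i => f (first α i) := by
  rw [tab, List.map_ofFn]
  congr 1
  funext i
  simp only [Function.comp]
  have key : ∀ (k : ℕ) (hk : 0 < k) (g : Fin k → ℕ), (List.ofFn g).headI = g ⟨0, hk⟩ := by
    intro k hk g
    cases k with
    | zero => omega
    | succ k => simp [List.ofFn_succ]
  exact key _ _ _

theorem isImmaculate_tab {n : ℕ} {α : Composition n} (f : Cell α → ℕ) (β : Composition n) :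
    IsImmaculate (tab f) α.blocks β.blocks ↔ FImm f β := by
  unfold IsImmaculate
  rw [← cum_iff]
  have hrow : (∀ r ∈ tab f, List.IsChain (· ≤ ·) r) ↔
      ∀ (i : Fin α.length) (j j' : Fin (α.blocksFun i)), j < j' → f ⟨i, j⟩ ≤ f ⟨i, j'⟩ := by
    simp only [tab, List.mem_ofFn', Set.mem_range, forall_exists_index,
      forall_apply_eq_imp_iff, List.isChain_iff_pairwise, List.pairwise_ofFn]
  have hcol : List.IsChain (· < ·) ((tab f).map List.headI) ↔
      ∀ i i' : Fin α.length, i < i' → f (first α i) < f (first α i') := by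
    rw [heads_tab, List.isChain_iff_pairwise, List.pairwise_ofFn]
  constructor
  · rintro ⟨-, h1, h2, h3⟩
    exact ⟨hrow.1 h1, hcol.1 h2, h3⟩
  · rintro ⟨h1, h2, h3⟩
    exact ⟨tab_lengths f, hrow.2 h1, hcol.2 h2, h3⟩

theorem rowIdx_tab {n : ℕ} {α : Composition n} (f : Cell α → ℕ) (hf : Function.Injective f)
    (c : Cell α) : rowIdx (tab f) (f c) = c.1 := by
  unfold rowIdx
  rw [List.findIdx_eq (by simp [tab])]
  constructor
  · simp only [tab, List.getElem_ofFn, decide_eq_true_eq, List.mem_ofFn', Set.mem_range]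
    exact ⟨c.2, rfl⟩
  · intro j hj
    simp only [tab, List.getElem_ofFn, decide_eq_false_iff_not, List.mem_ofFn', Set.mem_range]
    rintro ⟨y, hy⟩
    have := congrArg (fun c : Cell α => (c.1 : ℕ)) (hf hy)
    simp at this
    omega

/-- The block index of a number. -/
noncomputable def blk {n : ℕ} (β : Composition n) (x : ℕ) : ℕ := sInf {v | x ≤ β.sizeUpTo v}

theorem blk_le_iff {n : ℕ} (β : Composition n) {x : ℕ} (hx : x ≤ n) (v : ℕ) :
    blk β x ≤ v ↔ x ≤ β.sizeUpTo v := by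
  constructor
  · intro h
    have : blk β x ∈ {v | x ≤ β.sizeUpTo v} :=
      Nat.sInf_mem ⟨β.length, by simpa using hx⟩
    exact le_trans this (β.monotone_sizeUpTo h)
  · intro h
    exact Nat.sInf_le h

theorem blk_mono {n : ℕ} (β : Composition n) {x y : ℕ} (hxy : x ≤ y) (hy : y ≤ n) :
    blk β x ≤ blk β y := by
  rw [blk_le_iff β (hxy.trans hy)]
  exact hxy.trans ((blk_le_iff β hy _).1 le_rfl)

theorem mem_compS_iff {n : ℕ} (β : Composition n) {i : ℕ} (h1 : 1 ≤ i) (h2 : i < n) :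
    i ∈ compS β ↔ blk β i < blk β (i + 1) := by
  unfold compS
  rw [Finset.mem_image]
  constructor
  · rintro ⟨j, -, hj⟩
    have a : blk β i ≤ j := (blk_le_iff β h2.le j).2 hj.ge
    have b : ¬ blk β (i + 1) ≤ j := by
      rw [blk_le_iff β (by omega)]
      omega
    omega
  · intro h
    refine ⟨blk β i, ?_, ?_⟩
    · rw [Finset.mem_Ico]
      constructor
      · by_contra hc
        have : blk β i ≤ 0 := by omega
        rw [blk_le_iff β h2.le, β.sizeUpTo_zero] at this
        omega
      · have : blk β (i + 1) ≤ β.length := by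
          rw [blk_le_iff β (by omega), β.sizeUpTo_length]
          omega
        omega
    · have a := (blk_le_iff β h2.le (blk β i)).1 le_rfl
      have b : ¬ blk β (i + 1) ≤ blk β i := by omega
      rw [blk_le_iff β (by omega)] at b
      omega

/-- The sorting key of a cell. -/
def key {n : ℕ} {α : Composition n} (f : Cell α → ℕ) (c : Cell α) :
    ℕ ×ₗ ((Fin α.length)ᵒᵈ ×ₗ ℕ) :=
  toLex (f c, toLex (OrderDual.toDual c.1, (c.2 : ℕ)))

theorem key_lt_iff {n : ℕ} {α : Composition n} (f : Cell α → ℕ) (c c' : Cell α) :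
    key f c < key f c' ↔ f c < f c' ∨ f c = f c' ∧
      (c'.1 < c.1 ∨ c.1 = c'.1 ∧ (c.2 : ℕ) < c'.2) := by
  simp [key, Prod.Lex.toLex_lt_toLex]

theorem key_injective {n : ℕ} {α : Composition n} (f : Cell α → ℕ) :
    Function.Injective (key f) := by
  rintro ⟨i, j⟩ ⟨i', j'⟩ h
  simp only [key, EmbeddingLike.apply_eq_iff_eq, Prod.mk.injEq] at h
  obtain ⟨-, rfl, h2⟩ := h
  simp only [Sigma.mk.injEq, heq_eq_eq, true_and]
  exact Fin.ext h2

/-- Standardization. -/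
def std {n : ℕ} {α : Composition n} (f : Cell α → ℕ) (c : Cell α) : ℕ :=
  (Finset.univ.filter fun c' => key f c' ≤ key f c).card

theorem std_lt {n : ℕ} {α : Composition n} (f : Cell α → ℕ) {c c' : Cell α}
    (h : key f c < key f c') : std f c < std f c' := by
  apply Finset.card_lt_card
  rw [Finset.ssubset_iff_of_subset]
  · exact ⟨c', by simp, by simpa using h⟩
  · intro d
    simp only [Finset.mem_filter, Finset.mem_univ, true_and]
    intro hd
    exact hd.trans h.le

theorem std_lt_iff {n : ℕ} {α : Composition n} (f : Cell α → ℕ) {c c' : Cell α} :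
    std f c < std f c' ↔ key f c < key f c' := by
  refine ⟨fun h => ?_, std_lt f⟩
  by_contra hc
  rcases (not_lt.1 hc).lt_or_eq with h1 | h1
  · exact absurd (std_lt f h1) (by omega)
  · rw [key_injective f h1] at h
    omega

theorem std_injective {n : ℕ} {α : Composition n} (f : Cell α → ℕ) :
    Function.Injective (std f) := by
  intro c c' h
  apply key_injective f
  by_contra hne
  rcases lt_or_gt_of_ne hne with h1 | h1
  · have := std_lt f h1; omega
  · have := std_lt f h1; omega

theorem std_mem {n : ℕ} {α : Composition n} (f : Cell α → ℕ) (c : Cell α) :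
    1 ≤ std f c ∧ std f c ≤ n := by
  constructor
  · apply Finset.card_pos.2
    exact ⟨c, by simp⟩
  · conv_rhs => rw [← card_cell α]
    exact Finset.card_le_univ _

theorem std_image {n : ℕ} {α : Composition n} (f : Cell α → ℕ) :
    Finset.univ.image (std f) = Finset.Icc 1 n := by
  apply Finset.eq_of_subset_of_card_le
  · intro x hx
    obtain ⟨c, -, rfl⟩ := Finset.mem_image.1 hx
    exact Finset.mem_Icc.2 (std_mem f c)
  · rw [Finset.card_image_of_injective _ (std_injective f), Finset.card_univ, card_cell]
    simp

theorem std_cum {n : ℕ} {α : Composition n} (f : Cell α → ℕ) (v : ℕ) :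
    (Finset.univ.filter fun c => std f c ≤ v).card = (Composition.ones n).sizeUpTo v := by
  rw [Composition.ones_sizeUpTo, ← Finset.card_image_of_injective _ (std_injective f)]
  have : (Finset.univ.filter fun c => std f c ≤ v).image (std f) = Finset.Icc 1 (min v n) := by
    ext x
    have hx := Finset.ext_iff.1 (std_image f) x
    simp only [Finset.mem_image, Finset.mem_univ, true_and, Finset.mem_Icc] at hx
    simp only [Finset.mem_image, Finset.mem_filter, Finset.mem_univ, true_and, Finset.mem_Icc]
    constructor
    · rintro ⟨c, h1, rfl⟩
      have := std_mem f c
      omega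
    · intro h
      obtain ⟨c, hc⟩ := hx.2 (by omega)
      exact ⟨c, by omega, hc⟩
  rw [this]
  simp

/-- Facts on standard fillings. -/
theorem std_facts {n : ℕ} {α : Composition n} {s : Cell α → ℕ}
    (hs : FImm s (Composition.ones n)) :
    Function.Injective s ∧ (∀ c, 1 ≤ s c ∧ s c ≤ n) ∧ (∀ x, 1 ≤ x → x ≤ n → ∃ c, s c = x) := by
  have hcum := hs.cum
  simp only [Composition.ones_sizeUpTo] at hcum
  have hbd : ∀ c, 1 ≤ s c ∧ s c ≤ n := by
    intro c
    constructor
    · have h0 := hcum 0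
      rw [Nat.zero_min, Finset.card_eq_zero, Finset.filter_eq_empty_iff] at h0
      have := h0 (Finset.mem_univ c)
      omega
    · have h0 := hcum n
      rw [min_self] at h0
      have h1 : (Finset.univ.filter fun c => s c ≤ n) = Finset.univ := by
        apply Finset.eq_univ_of_card
        rw [h0, card_cell]
      exact (Finset.mem_filter.1 (h1.symm ▸ Finset.mem_univ c : c ∈ Finset.univ.filter fun c => s c ≤ n)).2
  have hsurj : ∀ x, 1 ≤ x → x ≤ n → ∃ c, s c = x := by
    intro x h1 h2
    obtain ⟨y, rfl⟩ : ∃ y, x = y + 1 := ⟨x - 1, by omega⟩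
    have h3 := card_le_succ s y
    rw [hcum, hcum] at h3
    have : 0 < (Finset.univ.filter fun c => s c = y + 1).card := by omega
    obtain ⟨c, hc⟩ := Finset.card_pos.1 this
    exact ⟨c, (Finset.mem_filter.1 hc).2⟩
  refine ⟨?_, hbd, hsurj⟩
  have him : Finset.univ.image s = Finset.Icc 1 n := by
    ext x
    simp only [Finset.mem_image, Finset.mem_univ, true_and, Finset.mem_Icc]
    constructor
    · rintro ⟨c, rfl⟩
      exact hbd c
    · rintro ⟨h1, h2⟩
      exact hsurj x h1 h2
  have : (Finset.univ.image s).card = (Finset.univ : Finset (Cell α)).card := by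
    rw [him, Finset.card_univ, card_cell]
    simp
  have h2 := Finset.card_image_iff.1 this
  intro a b hab
  exact h2 (by simp) (by simp) hab

/-- Descent condition on fillings. -/
def DescIn {n : ℕ} {α : Composition n} (s : Cell α → ℕ) (β : Composition n) : Prop :=
  ∀ c c' : Cell α, s c' = s c + 1 → c.1 < c'.1 → blk β (s c) < blk β (s c')

theorem descSet_subset_iff {n : ℕ} {α : Composition n} {s : Cell α → ℕ}
    (hs : FImm s (Composition.ones n)) (β : Composition n) :
    descSet (tab s) n ⊆ compS β ↔ DescIn s β := by
  obtain ⟨hinj, hbd, hsurj⟩ := std_facts hs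
  constructor
  · intro h c c' hcc hr
    have b1 := hbd c
    have b2 := hbd c'
    rw [hcc, ← mem_compS_iff β (by omega) (by omega)]
    apply h
    unfold descSet
    rw [Finset.mem_filter, Finset.mem_Ico, ← hcc, rowIdx_tab s hinj, rowIdx_tab s hinj]
    exact ⟨by omega, hr⟩
  · intro h i hi
    unfold descSet at hi
    rw [Finset.mem_filter, Finset.mem_Ico] at hi
    obtain ⟨⟨h1, h2⟩, h3⟩ := hi
    obtain ⟨c, rfl⟩ := hsurj i h1 h2.le
    obtain ⟨c', hc'⟩ := hsurj (s c + 1) (by omega) (by omega)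
    rw [mem_compS_iff β h1 h2, ← hc']
    apply h c c' hc'
    rw [← hc', rowIdx_tab s hinj, rowIdx_tab s hinj] at h3
    exact h3

/-- Within a block the rows weakly decrease. -/
theorem row_anti {n : ℕ} {α : Composition n} {s : Cell α → ℕ}
    (hs : FImm s (Composition.ones n)) {β : Composition n} (hd : DescIn s β)
    (k : ℕ) : ∀ c c' : Cell α, s c' = s c + k → blk β (s c) = blk β (s c') → c'.1 ≤ c.1 := by
  obtain ⟨hinj, hbd, hsurj⟩ := std_facts hs
  induction k with
  | zero =>
    intro c c' h _
    have h' : c' = c := hinj (by simpa using h)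
    rw [h']
  | succ k ih =>
    intro c c' h hb
    have b1 := hbd c
    have b2 := hbd c'
    obtain ⟨d, hd'⟩ := hsurj (s c + k) (by omega) (by omega)
    have m1 : blk β (s c) ≤ blk β (s d) := blk_mono β (by omega) (by omega)
    have m2 : blk β (s d) ≤ blk β (s c') := blk_mono β (by omega) (by omega)
    refine le_trans ?_ (ih c d hd' (by omega))
    by_contra hc
    have := hd d c' (by omega) (not_le.1 hc)
    omega

theorem key_lt_of_std {n : ℕ} {α : Composition n} {s : Cell α → ℕ}
    (hs : FImm s (Composition.ones n)) {β : Composition n} (hd : DescIn s β) {c c' : Cell α}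
    (h : key (fun c => blk β (s c)) c < key (fun c => blk β (s c)) c') : s c < s c' := by
  obtain ⟨hinj, hbd, hsurj⟩ := std_facts hs
  by_contra hc
  have hc := not_lt.1 hc
  rw [key_lt_iff] at h
  have m : blk β (s c') ≤ blk β (s c) := blk_mono β hc (hbd c).2
  rcases h with h | ⟨h1, h | ⟨h2, h3⟩⟩
  · omega
  · have := row_anti hs hd (s c - s c') c' c (by omega) h1.symm
    exact absurd h (not_lt.2 this)
  · obtain ⟨i, j⟩ := c
    obtain ⟨i', j'⟩ := c'
    obtain rfl : i = i' := h2
    have h4 : j < j' := h3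
    have := hs.row i j j' h4
    have h5 := hinj (le_antisymm this hc)
    simp only [Sigma.mk.injEq, heq_eq_eq, true_and] at h5
    exact absurd h4 (by simp [h5])

theorem std_blk {n : ℕ} {α : Composition n} {s : Cell α → ℕ}
    (hs : FImm s (Composition.ones n)) {β : Composition n} (hd : DescIn s β) :
    std (fun c => blk β (s c)) = s := by
  funext c
  obtain ⟨hinj, hbd, hsurj⟩ := std_facts hs
  have hle : ∀ c', key (fun c => blk β (s c)) c' ≤ key (fun c => blk β (s c)) c ↔ s c' ≤ s c := by
    intro c'
    constructor
    · intro h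
      rcases h.lt_or_eq with h | h
      · exact (key_lt_of_std hs hd h).le
      · rw [key_injective _ h]
    · intro h
      by_contra hc
      have := key_lt_of_std hs hd (not_le.1 hc)
      omega
  unfold std
  simp only [hle]
  rw [hs.cum, Composition.ones_sizeUpTo]
  have := hbd c
  omega

theorem fimm_blk {n : ℕ} {α : Composition n} {s : Cell α → ℕ}
    (hs : FImm s (Composition.ones n)) {β : Composition n} (hd : DescIn s β) :
    FImm (fun c => blk β (s c)) β := by
  obtain ⟨hinj, hbd, hsurj⟩ := std_facts hs
  refine ⟨?_, ?_, ?_⟩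
  · intro i j j' h
    exact blk_mono β (hs.row i j j' h) (hbd _).2
  · intro i i' h
    have h1 := hs.col i i' h
    apply lt_of_le_of_ne (blk_mono β h1.le (hbd _).2)
    intro h2
    have := row_anti hs hd (s (first α i') - s (first α i)) (first α i) (first α i')
      (by omega) h2
    exact absurd h (not_lt.2 this)
  · intro v
    have : ∀ c, blk β (s c) ≤ v ↔ s c ≤ β.sizeUpTo v := fun c => blk_le_iff β (hbd c).2 v
    simp only [this]
    rw [hs.cum, Composition.ones_sizeUpTo, min_eq_left (β.sizeUpTo_le v)]

theorem blk_std {n : ℕ} {α : Composition n} {f : Cell α → ℕ} {β : Composition n}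
    (hf : FImm f β) (c : Cell α) : blk β (std f c) = f c := by
  apply eq_of_forall_ge_iff
  intro v
  rw [blk_le_iff β (std_mem f c).2, ← hf.cum]
  constructor
  · intro h
    by_contra hc
    apply absurd h
    rw [not_le]
    apply Finset.card_lt_card
    rw [Finset.ssubset_iff_of_subset]
    · exact ⟨c, by simp, by simpa using hc⟩
    · intro d
      simp only [Finset.mem_filter, Finset.mem_univ, true_and]
      intro hd
      apply le_of_lt
      rw [key_lt_iff]
      left
      omega
  · intro h
    apply Finset.card_le_card
    intro d
    simp only [Finset.mem_filter, Finset.mem_univ, true_and]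
    intro hd
    rw [← not_lt, key_lt_iff] at hd
    omega

theorem fimm_std {n : ℕ} {α : Composition n} {f : Cell α → ℕ} {β : Composition n}
    (hf : FImm f β) : FImm (std f) (Composition.ones n) := by
  refine ⟨?_, ?_, std_cum f⟩
  · intro i j j' h
    apply le_of_lt
    apply std_lt
    rw [key_lt_iff]
    rcases (hf.row i j j' h).lt_or_eq with h1 | h1
    · exact Or.inl h1
    · exact Or.inr ⟨h1, Or.inr ⟨rfl, h⟩⟩
  · intro i i' h
    apply std_lt
    rw [key_lt_iff]
    exact Or.inl (hf.col i i' h)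

theorem descIn_std {n : ℕ} {α : Composition n} {f : Cell α → ℕ} {β : Composition n}
    (hf : FImm f β) : DescIn (std f) β := by
  intro c c' h hr
  rw [blk_std hf, blk_std hf]
  have h1 : std f c < std f c' := by omega
  rw [std_lt_iff, key_lt_iff] at h1
  rcases h1 with h1 | ⟨h1, h2 | ⟨h2, -⟩⟩
  · exact h1
  · exact absurd hr (not_lt.2 h2.le)
  · exact absurd hr (by simp [h2])

/-- The standardization bijection. -/
noncomputable def stdEquiv {n : ℕ} (α β : Composition n) :
    {f : Cell α → ℕ // FImm f β} ≃
      {s : Cell α → ℕ // FImm s (Composition.ones n) ∧ DescIn s β} where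
  toFun f := ⟨std f.1, fimm_std f.2, descIn_std f.2⟩
  invFun s := ⟨fun c => blk β (s.1 c), fimm_blk s.2.1 s.2.2⟩
  left_inv f := Subtype.ext (funext (blk_std f.2))
  right_inv s := Subtype.ext (std_blk s.2.1 s.2.2)

/-- Transport of subtypes along `tab`. -/
theorem card_tab {n : ℕ} (α : Composition n) (P : List (List ℕ) → Prop)
    (hP : ∀ T, P T → T.map List.length = α.blocks) :
    Nat.card {T : List (List ℕ) // P T} = Nat.card {f : Cell α → ℕ // P (tab f)} := by
  symm
  apply Nat.card_congr
  refine Equiv.ofBijective (fun f => ⟨tab f.1, f.2⟩) ⟨?_, ?_⟩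
  · intro f g h
    exact Subtype.ext (tab_injective (congrArg Subtype.val h))
  · rintro ⟨T, hT⟩
    obtain ⟨f, rfl⟩ := exists_tab T (hP T hT)
    exact ⟨⟨f, hT⟩, rfl⟩

theorem Kab_eq {n : ℕ} (α β : Composition n) :
    Kab α β = Nat.card {T : List (List ℕ) //
      IsImmaculate T α.blocks (List.replicate n 1) ∧ descSet T n ⊆ compS β} := by
  unfold Kab
  rw [card_tab α _ (fun T h => h.1), card_tab α _ (fun T h => h.1.1)]
  apply Nat.card_congr
  refine Equiv.trans (Equiv.subtypeEquivRight fun f => isImmaculate_tab f β) ?_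
  refine Equiv.trans (stdEquiv α β) (Equiv.subtypeEquivRight fun f => ?_)
  rw [← Composition.ones_blocks, isImmaculate_tab]
  constructor
  · rintro ⟨h1, h2⟩
    exact ⟨h1, (descSet_subset_iff h1 β).2 h2⟩
  · rintro ⟨h1, h2⟩
    exact ⟨h1, (descSet_subset_iff h1 β).1 h2⟩

theorem finite_std {n : ℕ} (α : Composition n) :
    Finite {T : List (List ℕ) // IsImmaculate T α.blocks (List.replicate n 1)} := by
  have : Set.Finite (tab '' (Set.Iic (fun _ : Cell α => n))) := (Set.finite_Iic _).image _
  refine Set.Finite.subset this ?_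
  intro T hT
  obtain ⟨f, rfl⟩ := exists_tab T hT.1
  refine ⟨f, ?_, rfl⟩
  have hT' : IsImmaculate (tab f) α.blocks (List.replicate n 1) := hT
  rw [← Composition.ones_blocks, isImmaculate_tab] at hT'
  intro c
  exact ((std_facts hT').2.1 c).2

theorem compS_subset {n : ℕ} (γ : Composition n) : compS γ ⊆ Finset.Ico 1 n := by
  intro x hx
  unfold compS at hx
  rw [Finset.mem_image] at hx
  obtain ⟨j, hj, rfl⟩ := hx
  rw [Finset.mem_Ico] at hj ⊢
  constructor
  · have h0 := γ.sizeUpTo_strict_mono (i := 0) (by omega)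
    have h1 := γ.monotone_sizeUpTo (show 0 + 1 ≤ j by omega)
    omega
  · have h0 := γ.sizeUpTo_strict_mono hj.2
    have := γ.sizeUpTo_le (j + 1)
    omega

theorem mem_boundaries {n : ℕ} (γ : Composition n) (x : Fin (n + 1)) :
    x ∈ γ.boundaries ↔ (x : ℕ) = 0 ∨ (x : ℕ) = n ∨ (x : ℕ) ∈ compS γ := by
  have h : x ∈ γ.boundaries ↔ ∃ j, j ≤ γ.length ∧ γ.sizeUpTo j = x := by
    simp only [Composition.boundaries, Finset.mem_map, Finset.mem_univ, true_and]
    constructor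
    · rintro ⟨j, rfl⟩
      exact ⟨j, by omega, rfl⟩
    · rintro ⟨j, h1, h2⟩
      exact ⟨⟨j, by omega⟩, Fin.ext h2⟩
  rw [h]
  unfold compS
  simp only [Finset.mem_image, Finset.mem_Ico]
  constructor
  · rintro ⟨j, h1, h2⟩
    rcases Nat.eq_zero_or_pos j with rfl | h0
    · left
      rw [← h2, γ.sizeUpTo_zero]
    · rcases h1.lt_or_eq with h3 | rfl
      · exact Or.inr (Or.inr ⟨j, ⟨h0, h3⟩, h2⟩)
      · right; left
        rw [← h2, γ.sizeUpTo_length]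
  · rintro (h | h | ⟨j, h1, h2⟩)
    · exact ⟨0, by omega, by rw [h, γ.sizeUpTo_zero]⟩
    · exact ⟨γ.length, le_rfl, by rw [h, γ.sizeUpTo_length]⟩
    · exact ⟨j, h1.2.le, h2⟩

theorem compS_injective {n : ℕ} : Function.Injective (compS : Composition n → Finset ℕ) := by
  intro γ γ' h
  apply (compositionEquiv n).injective
  apply CompositionAsSet.ext
  change γ.boundaries = γ'.boundaries
  ext x
  rw [mem_boundaries, mem_boundaries, h]

theorem exists_compS {n : ℕ} (D : Finset ℕ) (hD : D ⊆ Finset.Ico 1 n) :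
    ∃ γ : Composition n, compS γ = D := by
  have h : Finset.univ.image (compS : Composition n → Finset ℕ) = (Finset.Ico 1 n).powerset := by
    apply Finset.eq_of_subset_of_card_le
    · intro x hx
      obtain ⟨γ, -, rfl⟩ := Finset.mem_image.1 hx
      exact Finset.mem_powerset.2 (compS_subset γ)
    · rw [Finset.card_image_of_injective _ compS_injective, Finset.card_univ, composition_card,
        Finset.card_powerset, Nat.card_Ico]
  have h2 := Finset.mem_powerset.2 hD
  rw [← h, Finset.mem_image] at h2
  obtain ⟨γ, -, h3⟩ := h2
  exact ⟨γ, h3⟩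

theorem card_sum {n : ℕ} (α β : Composition n) :
    Nat.card {T : List (List ℕ) //
      IsImmaculate T α.blocks (List.replicate n 1) ∧ descSet T n ⊆ compS β} =
    ∑ γ ∈ Finset.univ.filter (fun γ : Composition n => compS γ ⊆ compS β),
      Nat.card {T : List (List ℕ) //
        IsImmaculate T α.blocks (List.replicate n 1) ∧ descSet T n = compS γ} := by
  classical
  have hfin : Set.Finite {T : List (List ℕ) | IsImmaculate T α.blocks (List.replicate n 1)} :=
    finite_std α
  set S := hfin.toFinset with hS
  have hc : ∀ Q : List (List ℕ) → Prop, Nat.card {T : List (List ℕ) //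
      IsImmaculate T α.blocks (List.replicate n 1) ∧ Q T} = (S.filter Q).card := by
    intro Q
    apply Nat.subtype_card
    intro T
    simp [hS]
  rw [hc]
  simp only [hc]
  rw [← Finset.card_biUnion]
  · congr 1
    ext T
    simp only [Finset.mem_filter, Finset.mem_biUnion, Finset.mem_univ, true_and]
    constructor
    · rintro ⟨h1, h2⟩
      obtain ⟨γ, hγ⟩ := exists_compS (n := n) (descSet T n) (Finset.filter_subset _ _)
      exact ⟨γ, hγ ▸ h2, h1, hγ.symm⟩
    · rintro ⟨γ, h1, h2, h3⟩
      exact ⟨h2, h3 ▸ h1⟩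
  · intro γ _ γ' _ hne
    rw [Function.onFun, Finset.disjoint_left]
    intro T h1 h2
    simp only [Finset.mem_filter] at h1 h2
    apply hne
    apply compS_injective
    rw [← h1.2, ← h2.2]

end DualImm

/-- The dual immaculate function expands positively in the fundamental basis:
`𝔖*_α = Σ_T F_{D(T)}`, summed over all standard immaculate tableaux `T` of shape `α`
(grouped here by the descent composition `D(T)`). -/
theorem dualImmaculate_fundamental_positive (n : ℕ) (α : Composition n) :
    dualImmaculate α = ∑ γ : Composition n,
      (Nat.card {T : List (List ℕ) //
          IsImmaculate T α.blocks (List.replicate n 1) ∧ descSet T n = compS γ} : ℚ) •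
        Fqs γ := by
  unfold dualImmaculate Fqs
  simp only [Finset.smul_sum, Finset.sum_filter]
  rw [Finset.sum_comm]
  refine Finset.sum_congr rfl fun β _ => ?_
  rw [DualImm.Kab_eq, DualImm.card_sum, Nat.cast_sum, Finset.sum_smul, Finset.sum_filter]
  refine Finset.sum_congr rfl fun γ _ => ?_
  split_ifs <;> simp
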